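/- Every simple planar graph G on n ≥ 3 vertices has at most 8n − 16 cliques. -/

import Mathlib

open Classical in
noncomputable def cliqueCount {V : Type*} [Fintype V] (G : SimpleGraph V) : ℕ :=
  (Finset.univ.filter fun s : Finset V => G.IsClique (s : Set V)).card

/-- A plane embedding of a simple graph `G`: vertices are mapped to distinct points of the
plane, each edge `uv` is realised by a simple arc `emap u v` from `u` to `v` (parametrised
over `[0,1]`), the interior of each arc avoids all vertex points, and interiors of arcs
realising distinct edges are disjoint. -/
structure IsPlaneEmbedding {V : Type*} (G : SimpleGraph V)
    (vmap : V → ℝ × ℝ) (emap : V → V → ℝ → ℝ × ℝ) : Prop where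
  vinj : Function.Injective vmap
  symm : ∀ u v : V, G.Adj u v → ∀ t : ℝ, emap u v t = emap v u (1 - t)
  cont : ∀ u v : V, G.Adj u v → ContinuousOn (emap u v) (Set.Icc 0 1)
  inj : ∀ u v : V, G.Adj u v → Set.InjOn (emap u v) (Set.Icc 0 1)
  ends0 : ∀ u v : V, G.Adj u v → emap u v 0 = vmap u
  ends1 : ∀ u v : V, G.Adj u v → emap u v 1 = vmap v
  interior_avoids : ∀ u v : V, G.Adj u v → ∀ t ∈ Set.Ioo (0 : ℝ) 1, ∀ z : V,
    emap u v t ≠ vmap z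
  edges_disjoint : ∀ u v u' v' : V, G.Adj u v → G.Adj u' v' → s(u, v) ≠ s(u', v') →
    ∀ t ∈ Set.Ioo (0 : ℝ) 1, ∀ t' ∈ Set.Ioo (0 : ℝ) 1, emap u v t ≠ emap u' v' t'

/-- A graph is planar if it admits a plane embedding. -/
def IsPlanar {V : Type*} (G : SimpleGraph V) : Prop :=
  ∃ (vmap : V → ℝ × ℝ) (emap : V → V → ℝ → ℝ × ℝ), IsPlaneEmbedding G vmap emap


namespace PC

open Complex

lemma exists_log {A : Type*} [TopologicalSpace A] [SimplyConnectedSpace A]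
    [LocallyPathConnectedSpace A] (a₀ : A) (f : A → ℂ) (hf : Continuous f) (h0 : ∀ a, f a ≠ 0) :
    ∃ L : A → ℂ, Continuous L ∧ ∀ a, exp (L a) = f a := by
  obtain ⟨F, ⟨-, hF⟩, -⟩ := isCoveringMapOn_exp.existsUnique_continuousMap_lifts
    (⟨f, hf⟩ : C(A, ℂ)) (a₀ := a₀) (e₀ := log (f a₀)) (exp_log (h0 a₀)) (fun a => h0 a)
  exact ⟨F, F.continuous, fun a => congrFun hF a⟩

lemma log_unique (f : ℝ → ℂ) (L M : ℝ → ℂ) (hL : Continuous L) (hM : Continuous M)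
    (h1 : ∀ a, exp (L a) = f a) (h2 : ∀ a, exp (M a) = f a) : L 1 - L 0 = M 1 - M 0 := by
  have hf : Continuous f := by
    have : f = fun a => exp (L a) := funext fun a => (h1 a).symm
    rw [this]; fun_prop
  have hu := isCoveringMapOn_exp.existsUnique_continuousMap_lifts
    (⟨f, hf⟩ : C(ℝ, ℂ)) (a₀ := 0) (e₀ := L 0) (h1 0)
    (fun a => by simp [← h1 a])
  have := hu.unique (y₁ := ⟨L, hL⟩) (y₂ := ⟨fun a => M a + (L 0 - M 0), by fun_prop⟩)
    ⟨rfl, funext fun a => h1 a⟩ ⟨by simp, funext fun a => by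
      change exp (M a + (L 0 - M 0)) = f a
      have hz : f 0 ≠ 0 := by rw [← h1 0]; exact exp_ne_zero _
      rw [exp_add, exp_sub, h1, h2, h2, div_self hz, mul_one]⟩
  have := DFunLike.congr_fun this 1
  simp at this
  rw [this]; ring

open Classical in
noncomputable def W (g : ℝ → ℂ) (z : ℂ) : ℂ :=
  if h : ∃ L : ℝ → ℂ, Continuous L ∧ ∀ a, exp (L a) = g a - z then h.choose 1 - h.choose 0 else 0

lemma W_eq (g : ℝ → ℂ) (z : ℂ) (L : ℝ → ℂ) (hL : Continuous L) (h : ∀ a, exp (L a) = g a - z) :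
    W g z = L 1 - L 0 := by
  have hx : ∃ L : ℝ → ℂ, Continuous L ∧ ∀ a, exp (L a) = g a - z := ⟨L, hL, h⟩
  rw [W, dif_pos hx]
  exact log_unique _ _ _ hx.choose_spec.1 hL hx.choose_spec.2 h

lemma W_exp (g : ℝ → ℂ) (z : ℂ) (hg : Continuous g) (h : ∀ a, g a ≠ z) :
    exp (W g z) = (g 1 - z) / (g 0 - z) := by
  obtain ⟨L, hL, h'⟩ := exists_log (0:ℝ) (fun a => g a - z) (by fun_prop)
    (fun a => sub_ne_zero.2 (h a))
  rw [W_eq g z L hL h', exp_sub, h', h']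

lemma square (g h : ℝ → ℂ) (hg : Continuous g) (hh : Continuous h) (hd : ∀ s t, g s ≠ h t) :
    W g (h 0) + W h (g 1) = W g (h 1) + W h (g 0) := by
  obtain ⟨L, hL, h'⟩ := exists_log ((0:ℝ),(0:ℝ)) (fun a : ℝ × ℝ => g a.1 - h a.2) (by fun_prop)
    (fun a => sub_ne_zero.2 (hd a.1 a.2))
  have e : ∀ s, W h (g s) = L (s, 1) - L (s, 0) := by
    intro s
    rw [W_eq h (g s) (fun t => L (s, t) + Real.pi * I) (by fun_prop)
      (fun t => by rw [exp_add, h', exp_pi_mul_I]; ring)]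
    ring
  have e' : ∀ t, W g (h t) = L (1, t) - L (0, t) := by
    intro t
    rw [W_eq g (h t) (fun s => L (s, t)) (by fun_prop) (fun s => by rw [h'])]
  rw [e, e, e', e']; ring

/-- No drawing of `K₅` in which disjoint edges have disjoint images. -/
theorem no_K5 (p : Fin 5 → ℂ) (g : Fin 5 → Fin 5 → ℝ → ℂ)
    (hc : ∀ i j, i < j → Continuous (g i j))
    (h0 : ∀ i j, i < j → g i j 0 = p i) (h1 : ∀ i j, i < j → g i j 1 = p j)
    (hd : ∀ i j k l, i < j → k < l → i ≠ k → i ≠ l → j ≠ k → j ≠ l → ∀ s t, g i j s ≠ g k l t) :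
    False := by
  have hpt : ∀ i j k, i < j → i ≠ k → j ≠ k → ∀ s, g i j s ≠ p k := by
    intro i j k hij hik hjk s
    obtain ⟨l, hli, hlj, hlk⟩ : ∃ l : Fin 5, l ≠ i ∧ l ≠ j ∧ l ≠ k := by
      clear hij hik hjk
      revert i j k; decide
    rcases lt_or_gt_of_ne hlk with h | h
    · rw [← h1 l k h]; exact hd _ _ _ _ hij h hli.symm hik hlj.symm hjk _ _
    · rw [← h0 k l h]; exact hd _ _ _ _ hij h hik hli.symm hjk hlj.symm _ _
  have hne : ∀ i k, i ≠ k → p i ≠ p k := by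
    intro i k hik
    obtain ⟨j, hji, hjk⟩ : ∃ l : Fin 5, l ≠ i ∧ l ≠ k := by
      clear hik
      revert i k; decide
    rcases lt_or_gt_of_ne hji with h | h
    · rw [← h1 j i h]; exact hpt _ _ _ h hjk hik _
    · rw [← h0 i j h]; exact hpt _ _ _ h hik hjk _
  let θ : Fin 5 → Fin 5 → ℂ := fun i k =>
    if i < k then log (p k - p i) + Real.pi * I else log (p i - p k)
  have hθ : ∀ i k, i ≠ k → exp (θ i k) = p i - p k := by
    intro i k hik
    by_cases h : i < k
    · simp only [θ, h, if_true]
      rw [exp_add, exp_log (sub_ne_zero.2 (hne _ _ hik.symm)), exp_pi_mul_I]; ring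
    · simp only [θ, h, if_false]
      rw [exp_log (sub_ne_zero.2 (hne _ _ hik))]
  let ε : Fin 5 → Fin 5 → ℤ := fun i k => if i < k then 1 else -1
  have hε : ∀ i k, i ≠ k → θ i k = θ k i + ε i k * (Real.pi * I) := by
    intro i k hik
    rcases lt_or_gt_of_ne hik with h | h
    · simp [θ, ε, h, h.not_gt]
    · simp [θ, ε, h, h.not_gt]
  have hn : ∀ i j k, ∃ n : ℤ, i < j → i ≠ k → j ≠ k →
      W (g i j) (p k) = θ j k - θ i k + n * (2 * Real.pi * I) := by
    intro i j k
    by_cases h : i < j ∧ i ≠ k ∧ j ≠ k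
    · obtain ⟨h, h2, h3⟩ := h
      have := W_exp (g i j) (p k) (hc _ _ h) (hpt _ _ _ h h2 h3)
      rw [h0 _ _ h, h1 _ _ h, ← hθ _ _ h2, ← hθ _ _ h3, ← exp_sub, exp_eq_exp_iff_exists_int] at this
      obtain ⟨n, hn⟩ := this
      exact ⟨n, fun _ _ _ => hn⟩
    · exact ⟨0, fun a b c => absurd ⟨a, b, c⟩ h⟩
  choose n hn using hn
  have key : ∀ i j k l, i < j → k < l → i ≠ k → i ≠ l → j ≠ k → j ≠ l →
      ε j k + ε k i + ε l j + ε i l + 2 * (n i j k + n k l j - n i j l - n k l i) = 0 := by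
    intro i j k l hij hkl hik hil hjk hjl
    have := square (g i j) (g k l) (hc _ _ hij) (hc _ _ hkl) (hd _ _ _ _ hij hkl hik hil hjk hjl)
    rw [h0 _ _ hkl, h1 _ _ hkl, h0 _ _ hij, h1 _ _ hij, hn _ _ _ hij hik hjk,
      hn _ _ _ hij hil hjl, hn _ _ _ hkl hjk.symm hjl.symm, hn _ _ _ hkl hik.symm hil.symm,
      hε j k hjk, hε k i hik.symm, hε l j hjl.symm, hε i l hil] at this
    have hpi : (Real.pi * I : ℂ) ≠ 0 := by simp [Real.pi_ne_zero]
    have h2 : ((ε j k + ε k i + ε l j + ε i l + 2 * (n i j k + n k l j - n i j l - n k l i) : ℤ) : ℂ)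
        * (Real.pi * I) = 0 := by
      push_cast
      linear_combination this
    rcases mul_eq_zero.1 h2 with h | h
    · exact_mod_cast h
    · exact absurd h hpi
  have k1 := key 0 1 2 3 (by decide) (by decide) (by decide) (by decide) (by decide) (by decide)
  have k2 := key 0 2 1 3 (by decide) (by decide) (by decide) (by decide) (by decide) (by decide)
  have k3 := key 0 3 1 2 (by decide) (by decide) (by decide) (by decide) (by decide) (by decide)
  have k4 := key 0 1 2 4 (by decide) (by decide) (by decide) (by decide) (by decide) (by decide)
  have k5 := key 0 2 1 4 (by decide) (by decide) (by decide) (by decide) (by decide) (by decide)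
  have k6 := key 0 4 1 2 (by decide) (by decide) (by decide) (by decide) (by decide) (by decide)
  have k7 := key 0 1 3 4 (by decide) (by decide) (by decide) (by decide) (by decide) (by decide)
  have k8 := key 0 3 1 4 (by decide) (by decide) (by decide) (by decide) (by decide) (by decide)
  have k9 := key 0 4 1 3 (by decide) (by decide) (by decide) (by decide) (by decide) (by decide)
  have k10 := key 0 2 3 4 (by decide) (by decide) (by decide) (by decide) (by decide) (by decide)
  have k11 := key 0 3 2 4 (by decide) (by decide) (by decide) (by decide) (by decide) (by decide)
  have k12 := key 0 4 2 3 (by decide) (by decide) (by decide) (by decide) (by decide) (by decide)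
  have k13 := key 1 2 3 4 (by decide) (by decide) (by decide) (by decide) (by decide) (by decide)
  have k14 := key 1 3 2 4 (by decide) (by decide) (by decide) (by decide) (by decide) (by decide)
  have k15 := key 1 4 2 3 (by decide) (by decide) (by decide) (by decide) (by decide) (by decide)
  have e1 : ∀ i k : Fin 5, i < k → ε i k = 1 := fun i k h => by simp [ε, h]
  have e2 : ∀ i k : Fin 5, k < i → ε i k = -1 := fun i k h => by simp [ε, h.not_gt]
  have a01 := e1 0 1 (by decide)
  have a02 := e1 0 2 (by decide)
  have a03 := e1 0 3 (by decide)
  have a04 := e1 0 4 (by decide)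
  have a12 := e1 1 2 (by decide)
  have a13 := e1 1 3 (by decide)
  have a14 := e1 1 4 (by decide)
  have a23 := e1 2 3 (by decide)
  have a24 := e1 2 4 (by decide)
  have a34 := e1 3 4 (by decide)
  have b01 := e2 1 0 (by decide)
  have b02 := e2 2 0 (by decide)
  have b03 := e2 3 0 (by decide)
  have b04 := e2 4 0 (by decide)
  have b12 := e2 2 1 (by decide)
  have b13 := e2 3 1 (by decide)
  have b14 := e2 4 1 (by decide)
  have b23 := e2 3 2 (by decide)
  have b24 := e2 4 2 (by decide)
  have b34 := e2 4 3 (by decide)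
  simp only [a01, a02, a03, a04, a12, a13, a14, a23, a24, a34,
    b01, b02, b03, b04, b12, b13, b14, b23, b24, b34] at k1 k2 k3 k4 k5 k6 k7 k8 k9 k10 k11 k12 k13 k14 k15
  clear_value ε θ
  clear hn key e1 e2 hε hθ hne hpt hd h0 h1 hc a01 a02 a03 a04 a12 a13 a14 a23 a24 a34 b01 b02 b03 b04 b12 b13 b14 b23 b24 b34
  omega

end PC


namespace PC
open Finset
open Classical in
/-- Contract `v` into `u` (on the same vertex type; `v` becomes isolated). -/
def contr {V : Type*} (G : SimpleGraph V) (u v : V) : SimpleGraph V where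
  Adj x y := x ≠ y ∧ x ≠ v ∧ y ≠ v ∧ (G.Adj x y ∨ (x = u ∧ G.Adj v y) ∨ (y = u ∧ G.Adj x v))
  symm := ⟨by
    rintro x y ⟨h1, h2, h3, h4⟩
    refine ⟨h1.symm, h3, h2, ?_⟩
    rcases h4 with h | ⟨h, h'⟩ | ⟨h, h'⟩
    · exact Or.inl h.symm
    · exact Or.inr (Or.inr ⟨h, h'.symm⟩)
    · exact Or.inr (Or.inl ⟨h, h'.symm⟩)⟩
  loopless := ⟨fun x h => h.1 rfl⟩

inductive Minor {V : Type*} (G : SimpleGraph V) : SimpleGraph V → Prop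
  | refl : Minor G G
  | sub {H K : SimpleGraph V} : Minor G H → K ≤ H → Minor G K
  | contr {H : SimpleGraph V} {u v : V} : Minor G H → H.Adj u v → Minor G (contr H u v)

lemma Minor.trans {V : Type*} {G H K : SimpleGraph V} (h : Minor G H) (h' : Minor H K) :
    Minor G K := by
  induction h' with
  | refl => exact h
  | sub _ h2 ih => exact ih.sub h2
  | contr _ h2 ih => exact ih.contr h2

def Free {V : Type*} (t : ℕ) (G : SimpleGraph V) : Prop := ∀ H, Minor G H → H.CliqueFree t

lemma Free.minor {V : Type*} {t : ℕ} {G H : SimpleGraph V} (h : Free t G) (h' : Minor G H) :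
    Free t H := fun K hK => h K (h'.trans hK)

/-- the graph induced on the neighbourhood of `v` -/
def link {V : Type*} (G : SimpleGraph V) (v : V) : SimpleGraph V where
  Adj x y := G.Adj x y ∧ G.Adj v x ∧ G.Adj v y
  symm := ⟨fun _ _ h => ⟨h.1.symm, h.2.2, h.2.1⟩⟩
  loopless := ⟨fun _ h => h.1.ne rfl⟩

lemma contr_mono {V : Type*} {G H : SimpleGraph V} (h : G ≤ H) (u v : V) :
    contr G u v ≤ contr H u v := by
  rintro x y ⟨h1, h2, h3, h4⟩
  refine ⟨h1, h2, h3, ?_⟩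
  rcases h4 with h4 | ⟨h4, h5⟩ | ⟨h4, h5⟩
  · exact Or.inl (h h4)
  · exact Or.inr (Or.inl ⟨h4, h h5⟩)
  · exact Or.inr (Or.inr ⟨h4, h h5⟩)

lemma link_minor {V : Type*} {G H : SimpleGraph V} {v : V} (h : Minor (link G v) H) :
    ∃ G', Minor G G' ∧ H ≤ G' ∧ ∀ x y, H.Adj x y → G'.Adj v x := by
  induction h with
  | refl => exact ⟨G, .refl, fun x y h => h.1, fun x y h => h.2.1⟩
  | sub _ h2 ih =>
    obtain ⟨G', a, b, c⟩ := ih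
    exact ⟨G', a, h2.trans b, fun x y h => c x y (h2 h)⟩
  | @contr H a b _ h2 ih =>
    obtain ⟨G', p, q, r⟩ := ih
    refine ⟨_, p.contr (q h2), contr_mono q _ _, ?_⟩
    rintro x y ⟨h3, h4, h5, h6⟩
    have hva := r _ _ h2
    have hvb := r _ _ h2.symm
    have hvx : G'.Adj v x := by
      rcases h6 with h | ⟨h, h'⟩ | ⟨h, h'⟩
      · exact r _ _ h
      · rw [h]; exact hva
      · exact r _ _ h'
    exact ⟨hvx.ne, hvb.ne, h4, Or.inl hvx⟩

lemma Free.link {V : Type*} {t : ℕ} {G : SimpleGraph V} (h : Free (t + 3) G) (v : V) :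
    Free (t + 2) (link G v) := by
  classical
  intro H hH s hs
  obtain ⟨G', a, b, c⟩ := link_minor hH
  refine h G' a (insert v s) ?_
  have hs' : G'.IsNClique (t + 2) s := hs.mono b
  refine hs'.insert ?_
  intro x hx
  have : 1 < s.card := by rw [hs.card_eq]; omega
  obtain ⟨y, hy, hyx⟩ := Finset.exists_mem_ne this x
  exact c x y (hs.isClique hx hy hyx.symm)

section fin
variable {V : Type*} [Fintype V]
open Classical

noncomputable def ec (G : SimpleGraph V) : ℕ := (univ.filter fun e : V × V => G.Adj e.1 e.2).card

noncomputable def cn (G : SimpleGraph V) (u v : V) : Finset V :=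
  univ.filter fun x => G.Adj u x ∧ G.Adj v x

noncomputable def nb (G : SimpleGraph V) (u : V) : Finset V := univ.filter fun x => G.Adj u x

lemma ec_eq (G : SimpleGraph V) (S : Finset V) (hS : ∀ x y, G.Adj x y → x ∈ S) :
    ec G = ∑ x ∈ S, (nb G x).card := by
  have : (univ.filter fun e : V × V => G.Adj e.1 e.2) = (S.sigma (fun x => nb G x)).image
      (fun e => (e.1, e.2)) := by
    ext ⟨x, y⟩
    simp only [mem_filter, mem_univ, true_and, mem_image, mem_sigma, nb, Prod.mk.injEq]
    constructor
    · intro h; exact ⟨⟨x, y⟩, ⟨hS _ _ h, h⟩, rfl, rfl⟩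
    · rintro ⟨⟨a, b⟩, ⟨_, h⟩, rfl, rfl⟩; exact h
  rw [ec, this, card_image_of_injective, card_sigma]
  rintro ⟨a, b⟩ ⟨c, d⟩ h
  simp at h
  obtain ⟨rfl, rfl⟩ := h
  rfl

lemma ec_contr (G : SimpleGraph V) {u v : V} (huv : G.Adj u v) :
    ec G ≤ ec (contr G u v) + 2 + 2 * (cn G u v).card := by
  set A := univ.filter fun e : V × V => G.Adj e.1 e.2 with hA
  set B : Finset (V × V) := ({(u, v), (v, u)} : Finset (V × V)) ∪
    ((cn G u v).image (fun x => (v, x)) ∪ (cn G u v).image (fun x => (x, v))) with hB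
  have hBc : B.card ≤ 2 + 2 * (cn G u v).card := by
    have h1 := card_union_le ({(u, v), (v, u)} : Finset (V × V))
      ((cn G u v).image (fun x => (v, x)) ∪ (cn G u v).image (fun x => (x, v)))
    have h2 := card_union_le ((cn G u v).image (fun x => (v, x)))
      ((cn G u v).image (fun x => (x, v)))
    have h3 : ((cn G u v).image (fun x => (v, x))).card ≤ _ := card_image_le
    have h4 : ((cn G u v).image (fun x => (x, v))).card ≤ _ := card_image_le
    have h5 := card_le_two (a := (u, v)) (b := (v, u))
    rw [hB]
    omega
  have hAB : (A \ B).card ≤ ec (contr G u v) := by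
    refine card_le_card_of_injOn
      (fun e => ((if e.1 = v then u else e.1), (if e.2 = v then u else e.2))) ?_ ?_
    · rintro ⟨x, y⟩ h
      have hne := huv.ne
      simp only [hA, hB, cn, coe_sdiff, Set.mem_sdiff, mem_coe, mem_filter, mem_univ, true_and,
        mem_union, mem_insert, mem_singleton, mem_image, Prod.mk.injEq, contr] at h ⊢
      have := h.1.ne
      have hsy := G.adj_comm
      grind
    · rintro ⟨x, y⟩ h ⟨x', y'⟩ h' he
      have hne := huv.ne
      simp only [hA, hB, cn, coe_sdiff, Set.mem_sdiff, mem_coe, mem_filter, mem_univ, true_and,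
        mem_union, mem_insert, mem_singleton, mem_image, Prod.mk.injEq] at h h' he ⊢
      have := h.1.ne
      have := h'.1.ne
      have hsy := G.adj_comm
      grind
  have := card_le_card_sdiff_add_card (s := A) (t := B)
  have e : ec G = A.card := rfl
  omega

def del (G : SimpleGraph V) (a b : V) : SimpleGraph V where
  Adj x y := G.Adj x y ∧ ¬ (x = a ∧ y = b) ∧ ¬ (x = b ∧ y = a)
  symm := ⟨fun _ _ h => ⟨h.1.symm, fun h' => h.2.2 ⟨h'.2, h'.1⟩, fun h' => h.2.1 ⟨h'.2, h'.1⟩⟩⟩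
  loopless := ⟨fun _ h => h.1.ne rfl⟩

lemma ec_del (G : SimpleGraph V) {a b : V} (h : G.Adj a b) : ec G = ec (del G a b) + 2 := by
  have hs : (univ.filter fun e : V × V => G.Adj e.1 e.2) =
      (univ.filter fun e : V × V => (del G a b).Adj e.1 e.2) ∪ {(a, b), (b, a)} := by
    ext ⟨x, y⟩
    have := h.symm
    simp only [mem_filter, mem_univ, true_and, mem_union, mem_insert, mem_singleton,
      Prod.mk.injEq, del]
    grind
  rw [ec, hs, card_union_of_disjoint, card_pair, ec]
  · simp [h.ne]
  · rw [Finset.disjoint_left]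
    rintro ⟨x, y⟩ h1 h2
    simp only [mem_filter, mem_univ, true_and, mem_insert, mem_singleton, Prod.mk.injEq] at h1 h2
    simp only [del] at h1
    tauto

lemma del_le (G : SimpleGraph V) (a b : V) : del G a b ≤ G := fun _ _ h => h.1

def EB (V : Type*) [Fintype V] (m : ℕ) : Prop := ∀ (G : SimpleGraph V) (S : Finset V),
  (∀ x y, G.Adj x y → x ∈ S) → Free (m + 2) G → m ≤ S.card → ec G + m * (m + 1) ≤ 2 * m * S.card

lemma EB_zero : EB V 0 := by
  intro G S hS hF _
  have : ec G = 0 := by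
    rw [ec, card_eq_zero, filter_eq_empty_iff]
    rintro ⟨x, y⟩ _ h
    refine hF G .refl {x, y} ?_
    constructor
    · simp only [coe_insert, coe_singleton]
      rw [SimpleGraph.isClique_pair]
      exact fun _ => h
    · exact card_pair h.ne
  omega

lemma linkstep {m : ℕ} (hE : EB V m) (G : SimpleGraph V) (hF : Free (m + 3) G)
    (hcn : ∀ x y, G.Adj x y → m + 1 ≤ (cn G x y).card) {v w : V} (hvw : G.Adj v w) :
    m * m + m + (nb G v).card ≤ m * (nb G v).card := by
  have h1 := hE (link G v) (nb G v) (fun x y h => by simp [nb, h.2.1]) (hF.link v) ?_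
  · rw [ec_eq (link G v) (nb G v) (fun x y h => by simp [nb, h.2.1])] at h1
    have h2 : (nb G v).card • (m + 1) ≤ ∑ x ∈ nb G v, (nb (link G v) x).card := by
      refine Finset.card_nsmul_le_sum _ _ _ ?_
      intro x hx
      have hx : G.Adj v x := by simpa [nb] using hx
      refine (hcn v x hx).trans (card_le_card ?_)
      intro y hy
      simp only [cn, nb, mem_filter, mem_univ, true_and] at hy ⊢
      exact ⟨hy.2, hx, hy.1⟩
    rw [smul_eq_mul] at h2
    nlinarith
  · have := hcn _ _ hvw
    have h3 : (cn G v w).card ≤ (nb G v).card := card_le_card (fun y hy => by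
      simp only [cn, nb, mem_filter, mem_univ, true_and] at hy ⊢; exact hy.1)
    omega

lemma contr_supp {G : SimpleGraph V} {S : Finset V} (hS : ∀ x y, G.Adj x y → x ∈ S) {u v : V}
    (h : G.Adj u v) : ∀ x y, (contr G u v).Adj x y → x ∈ S.erase v := by
  rintro x y ⟨h1, h2, h3, h4⟩
  refine mem_erase.2 ⟨h2, ?_⟩
  rcases h4 with h | ⟨h', h''⟩ | ⟨h', h''⟩
  · exact hS _ _ h
  · rw [h']; exact hS _ _ h
  · exact hS _ _ h''

lemma EB_succ {m : ℕ} (hm : m ≤ 2) (hE : EB V m) : EB V (m + 1) := by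
  intro G S
  obtain ⟨M, hM⟩ : ∃ M, ∀ H : SimpleGraph V, ec H < M :=
    ⟨Fintype.card (V × V) + 1, fun H => Nat.lt_succ_of_le (card_le_univ _)⟩
  induction hN : S.card * M + ec G using Nat.strong_induction_on generalizing G S with
  | _ N ih =>
  subst hN
  intro hS hF hc
  by_contra hcon
  push Not at hcon
  rcases hc.eq_or_lt with hc' | hc'
  · have : ec G ≤ S.card * (S.card - 1) := by
      rw [ec_eq G S hS, ← smul_eq_mul]
      refine Finset.sum_le_card_nsmul _ _ _ ?_
      intro x hx
      rw [← card_erase_of_mem hx]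
      refine card_le_card ?_
      intro y hy
      simp only [nb, mem_filter, mem_univ, true_and] at hy
      exact mem_erase.2 ⟨hy.ne.symm, hS _ _ hy.symm⟩
    rw [← hc'] at this hcon
    simp only [Nat.add_sub_cancel] at this
    nlinarith
  obtain ⟨a, b, hab⟩ : ∃ a b, G.Adj a b := by
    by_contra hno
    push Not at hno
    have : ec G = 0 := by
      rw [ec, card_eq_zero, filter_eq_empty_iff]
      rintro ⟨x, y⟩ _ h
      exact hno _ _ h
    nlinarith
  have hdel := ec_del G hab
  have h1 := ih _ (by omega) (del G a b) S rfl (fun x y h => hS _ _ h.1)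
    (hF.minor (.sub .refl (del_le _ _ _))) hc
  have hex : ∀ x ∈ S, (S.erase x).card + 1 = S.card := fun x hx => card_erase_add_one hx
  have hex' : ∀ x ∈ S, (S.erase x).card * M + M = S.card * M := fun x hx => by
    rw [← hex x hx]; ring
  by_cases hcn : ∀ x y, G.Adj x y → m + 1 ≤ (cn G x y).card
  · have hlow : ∃ v w, G.Adj v w ∧ (m = 0 ∨ (nb G v).card ≤ 2 * m + 1) := by
      rcases Nat.eq_zero_or_pos m with h0 | h0
      · exact ⟨a, b, hab, Or.inl h0⟩
      obtain ⟨v, hv, hlt⟩ : ∃ v ∈ S, (nb G v).card < 2 * m + 2 := by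
        apply Finset.exists_lt_of_sum_lt
        rw [← ec_eq G S hS, sum_const, smul_eq_mul]
        nlinarith
      rcases Nat.eq_zero_or_pos (nb G v).card with h2 | h2
      · exfalso
        have hno : ∀ y, ¬ G.Adj v y := by
          intro y hy
          rw [card_eq_zero, nb, filter_eq_empty_iff] at h2
          exact h2 (mem_univ _) hy
        have := hex v hv
        have := hex' v hv
        have := hM G
        have h3 := ih ((S.erase v).card * M + ec G) (by omega) G (S.erase v) rfl
          (fun x y h => mem_erase.2 ⟨by rintro rfl; exact hno _ h, hS _ _ h⟩) hF (by omega)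
        nlinarith
      · obtain ⟨w, hw⟩ := card_pos.1 h2
        exact ⟨v, w, by simpa [nb] using hw, Or.inr (by omega)⟩
    obtain ⟨v, w, hvw, hd⟩ := hlow
    have h4 := linkstep hE G hF hcn hvw
    have h5 : 0 < (nb G v).card := card_pos.2 ⟨w, by simp [nb, hvw]⟩
    interval_cases m <;> omega
  · push Not at hcn
    obtain ⟨u, v, huv, hl⟩ := hcn
    have h6 := ec_contr G huv
    have hv := hS _ _ huv.symm
    have := hex v hv
    have h7 := hM (contr G u v)
    have h8 := hex' v hv
    have h3 := ih ((S.erase v).card * M + ec (contr G u v)) (by omega) (contr G u v) (S.erase v) rfl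
      (contr_supp hS huv) (hF.minor (.contr .refl huv)) (by omega)
    nlinarith

lemma exists_edge {G : SimpleGraph V} (hF : Free 5 G) {a b : V} (hab : G.Adj a b) :
    ∃ u v, G.Adj u v ∧ (cn G u v).card ≤ 2 := by
  by_contra hcon
  push Not at hcon
  have hE2 : EB V 2 := EB_succ (by omega) (EB_succ (by omega) EB_zero)
  have hE3 : EB V 3 := EB_succ (by omega) hE2
  set S : Finset V := univ.filter fun x => ∃ y, G.Adj x y with hSdef
  have hS : ∀ x y, G.Adj x y → x ∈ S := fun x y h => by
    simp only [hSdef, mem_filter, mem_univ, true_and]; exact ⟨y, h⟩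
  have h1 := hE3 G S hS hF (by
    refine le_trans (Nat.succ_le_of_lt (hcon a b hab)) (card_le_card ?_)
    intro y hy
    simp only [cn, mem_filter, mem_univ, true_and] at hy
    exact hS _ _ hy.1.symm)
  obtain ⟨v, hv, hlt⟩ : ∃ v ∈ S, (nb G v).card < 6 := by
    apply Finset.exists_lt_of_sum_lt
    rw [← ec_eq G S hS, sum_const, smul_eq_mul]
    omega
  simp only [hSdef, mem_filter, mem_univ, true_and] at hv
  obtain ⟨w, hw⟩ := hv
  have := linkstep hE2 G hF hcon hw
  omega

noncomputable def cc (G : SimpleGraph V) (S : Finset V) : Finset (Finset V) :=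
  S.powerset.filter fun s => G.IsClique (s : Set V)

lemma mem_cc {G : SimpleGraph V} {S s : Finset V} :
    s ∈ cc G S ↔ s ⊆ S ∧ ∀ x ∈ s, ∀ y ∈ s, x ≠ y → G.Adj x y := by
  simp [cc, SimpleGraph.isClique_iff, Set.Pairwise]

lemma cc_contr {G : SimpleGraph V} {S : Finset V} {u v : V} (huv : G.Adj u v)
    (hu : u ∈ S) (h2 : (cn G u v).card ≤ 2) :
    (cc G S).card ≤ (cc (contr G u v) (S.erase v)).card + 8 := by
  have hne := huv.ne
  have hsym := G.adj_comm
  set N := (cc G S).filter fun s => u ∉ s ∧ v ∉ s with hN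
  set X := (cc G S).filter fun s => u ∈ s ∧ v ∉ s with hX
  set Y := ((cc G S).filter fun s => u ∉ s ∧ v ∈ s) with hY
  set Z := ((cc G S).filter fun s => u ∈ s ∧ v ∈ s) with hZ
  set Y' := Y.image (fun s => insert u (s.erase v)) with hY'
  have hcov : cc G S ⊆ (N ∪ X) ∪ (Y ∪ Z) := by
    intro s hs
    simp only [hN, hX, hY, hZ, mem_union, mem_filter, hs, true_and]
    tauto
  have hpow : (cn G u v).powerset.card ≤ 4 := by
    rw [card_powerset]
    exact (Nat.pow_le_pow_right (by norm_num) h2).trans (by norm_num)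
  have hYc : Y'.card = Y.card := by
    refine card_image_of_injOn ?_
    intro s hs t ht he
    simp only [hY, coe_filter, Set.mem_ofPred_eq] at hs ht
    ext x
    have := Finset.ext_iff.1 he x
    simp only [mem_insert, mem_erase] at this
    by_cases hxv : x = v
    · subst hxv; tauto
    · by_cases hxu : x = u
      · subst hxu; tauto
      · tauto
  have hZc : Z.card ≤ 4 := by
    refine le_trans (card_le_card_of_injOn (fun s => (s.erase u).erase v) ?_ ?_) hpow
    · intro s hs
      simp only [hZ, coe_filter, Set.mem_ofPred_eq, mem_cc] at hs
      simp only [mem_coe, mem_powerset]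
      intro x hx
      simp only [mem_erase] at hx
      simp only [cn, mem_filter, mem_univ, true_and]
      exact ⟨hs.1.2 _ hs.2.1 _ hx.2.2 (Ne.symm hx.2.1), hs.1.2 _ hs.2.2 _ hx.2.2 (Ne.symm hx.1)⟩
    · intro s hs t ht he
      simp only [hZ, coe_filter, Set.mem_ofPred_eq] at hs ht
      ext x
      have := Finset.ext_iff.1 he x
      simp only [mem_erase] at this
      by_cases hxv : x = v
      · subst hxv; tauto
      · by_cases hxu : x = u
        · subst hxu; tauto
        · tauto
  have hXY : (X ∩ Y').card ≤ 4 := by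
    refine le_trans (card_le_card_of_injOn (fun s => s.erase u) ?_ ?_) hpow
    · intro s hs
      simp only [hX, hY', hY, coe_inter, Set.mem_inter_iff, mem_coe, mem_filter, mem_image,
        mem_cc] at hs
      obtain ⟨⟨⟨h3, h4⟩, h5, h6⟩, t, ⟨⟨h7, h8⟩, h9, h10⟩, rfl⟩ := hs
      simp only [mem_coe, mem_powerset]
      intro x hx
      simp only [cn, mem_filter, mem_univ, true_and]
      have hx1 := mem_erase.1 hx
      refine ⟨h4 _ h5 _ hx1.2 (Ne.symm hx1.1), ?_⟩
      rcases mem_insert.1 hx1.2 with h | h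
      · exact absurd h hx1.1
      · have h' := mem_erase.1 h
        exact h8 _ h10 _ h'.2 (Ne.symm h'.1)
    · intro s hs t ht he
      simp only [hX, coe_inter, Set.mem_inter_iff, mem_coe, mem_filter] at hs ht
      rw [← insert_erase hs.1.2.1, ← insert_erase ht.1.2.1]
      exact congrArg (insert u) he
  have hsub : N ∪ (X ∪ Y') ⊆ cc (contr G u v) (S.erase v) := by
    have hold : ∀ s ∈ cc G S, v ∉ s → s ∈ cc (contr G u v) (S.erase v) := by
      intro s hs hv
      rw [mem_cc] at hs ⊢
      refine ⟨fun x hx => mem_erase.2 ⟨by rintro rfl; exact hv hx, hs.1 hx⟩, ?_⟩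
      intro x hx y hy hxy
      exact ⟨hxy, by rintro rfl; exact hv hx, by rintro rfl; exact hv hy,
        Or.inl (hs.2 _ hx _ hy hxy)⟩
    intro s hs
    rcases mem_union.1 hs with h | h
    · have := mem_filter.1 h
      exact hold s this.1 this.2.2
    rcases mem_union.1 h with h | h
    · have := mem_filter.1 h
      exact hold s this.1 this.2.2
    obtain ⟨t, ht, rfl⟩ := mem_image.1 h
    obtain ⟨ht1, hut, hvt⟩ := mem_filter.1 ht
    rw [mem_cc] at ht1 ⊢
    refine ⟨?_, ?_⟩
    · intro x hx
      rcases mem_insert.1 hx with h | h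
      · rw [h]; exact mem_erase.2 ⟨hne, hu⟩
      · exact erase_subset_erase _ ht1.1 h
    · intro x hx y hy hxy
      rcases mem_insert.1 hx with hx1 | hx1
      · rcases mem_insert.1 hy with hy1 | hy1
        · exact absurd (hx1.trans hy1.symm) hxy
        · have hy2 := mem_erase.1 hy1
          exact ⟨hxy, by rw [hx1]; exact hne, hy2.1,
            Or.inr (Or.inl ⟨hx1, ht1.2 _ hvt _ hy2.2 (Ne.symm hy2.1)⟩)⟩
      · have hx2 := mem_erase.1 hx1
        rcases mem_insert.1 hy with hy1 | hy1
        · exact ⟨hxy, hx2.1, by rw [hy1]; exact hne,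
            Or.inr (Or.inr ⟨hy1, ht1.2 _ hx2.2 _ hvt hx2.1⟩)⟩
        · have hy2 := mem_erase.1 hy1
          exact ⟨hxy, hx2.1, hy2.1, Or.inl (ht1.2 _ hx2.2 _ hy2.2 hxy)⟩
  have hdis : Disjoint N (X ∪ Y') := by
    rw [Finset.disjoint_left]
    intro s hs hs'
    have h1 := (mem_filter.1 hs).2.1
    rcases mem_union.1 hs' with h | h
    · exact h1 (mem_filter.1 h).2.1
    · obtain ⟨t, ht, rfl⟩ := mem_image.1 h
      exact h1 (mem_insert_self _ _)
  have c1 := card_le_card hcov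
  have c2 := card_le_card hsub
  rw [card_union_of_disjoint hdis] at c2
  have c3 := card_union_add_card_inter X Y'
  have c4 := card_union_le (N ∪ X) (Y ∪ Z)
  have c5 := card_union_le N X
  have c6 := card_union_le Y Z
  omega

theorem cc_bound {G : SimpleGraph V} {S : Finset V} (hS : ∀ x y, G.Adj x y → x ∈ S)
    (hF : Free 5 G) (h3 : 3 ≤ S.card) : (cc G S).card + 16 ≤ 8 * S.card := by
  induction hN : S.card generalizing G S with
  | zero => omega
  | succ n ih =>
  rcases h3.eq_or_lt with h | h
  · have : (cc G S).card ≤ 2 ^ S.card := by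
      rw [← card_powerset]; exact card_filter_le _ _
    rw [← h] at this
    omega
  by_cases hab : ∃ a b, G.Adj a b
  · obtain ⟨a, b, hab⟩ := hab
    obtain ⟨u, v, huv, h2⟩ := exists_edge hF hab
    have h4 := cc_contr huv (hS _ _ huv) h2
    have h5 := card_erase_add_one (hS _ _ huv.symm)
    have := ih (contr_supp hS huv) (hF.minor (.contr .refl huv)) (by omega) (by omega)
    omega
  · push Not at hab
    have : cc G S ⊆ insert ∅ (S.image fun x => {x}) := by
      intro s hs
      rw [mem_cc] at hs
      rcases s.eq_empty_or_nonempty with rfl | ⟨x, hx⟩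
      · exact mem_insert_self _ _
      · refine mem_insert_of_mem (mem_image.2 ⟨x, hs.1 hx, ?_⟩)
        ext y
        rw [mem_singleton]
        constructor
        · rintro rfl; exact hx
        · intro hy
          by_contra hne
          exact hab _ _ (hs.2 _ hy _ hx hne)
    have h1 := card_le_card this
    have h2 := card_insert_le (∅ : Finset V) (S.image fun x => {x})
    have h3 : (S.image fun x => ({x} : Finset V)).card ≤ S.card := card_image_le
    omega

end fin

/-- weak drawings: independent edges have disjoint images -/
def Draw {V : Type*} (G : SimpleGraph V) : Prop :=
  ∃ (p : V → ℂ) (E : V → V → Set ℂ), (∀ u v, G.Adj u v → JoinedIn (E u v) (p u) (p v)) ∧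
    ∀ u v x y, G.Adj u v → G.Adj x y → u ≠ x → u ≠ y → v ≠ x → v ≠ y → Disjoint (E u v) (E x y)

lemma Draw.mono {V : Type*} {G H : SimpleGraph V} (h : Draw G) (hle : H ≤ G) : Draw H := by
  obtain ⟨p, E, h1, h2⟩ := h
  exact ⟨p, E, fun u v h => h1 u v (hle h), fun u v x y a b => h2 u v x y (hle a) (hle b)⟩

open Classical in
lemma Draw.contr {V : Type*} {G : SimpleGraph V} (h : Draw G) {u v : V} (huv : G.Adj u v) :
    Draw (contr G u v) := by
  obtain ⟨p, E, h1, h2⟩ := h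
  let E' : V → V → Set ℂ := fun x y =>
    if G.Adj x y then E x y else if x = u then E u v ∪ E v y else E x v ∪ E v u
  refine ⟨p, E', ?_, ?_⟩
  · rintro x y ⟨h3, h4, h5, h6⟩
    simp only [E']
    split_ifs with ha hb
    · exact h1 _ _ ha
    · subst hb
      have h7 : G.Adj v y := by
        rcases h6 with h | ⟨h, h'⟩ | ⟨h, h'⟩
        · exact absurd h ha
        · exact h'
        · exact absurd h.symm h3
      exact ((h1 _ _ huv).mono Set.subset_union_left).trans
        ((h1 _ _ h7).mono Set.subset_union_right)
    · have h7 : y = u ∧ G.Adj x v := by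
        rcases h6 with h | ⟨h, h'⟩ | ⟨h, h'⟩
        · exact absurd h ha
        · exact absurd h hb
        · exact ⟨h, h'⟩
      obtain ⟨rfl, h7⟩ := h7
      exact ((h1 _ _ h7).mono Set.subset_union_left).trans
        ((h1 _ _ huv.symm).mono Set.subset_union_right)
  · rintro a b x y ⟨h3, h4, h5, h6⟩ ⟨h3', h4', h5', h6'⟩ n1 n2 n3 n4
    have hvu := huv.symm
    simp only [E']
    split_ifs with q1 q2 q3 q4 q5 q6 q7 q8 <;>
      (try simp only [Set.disjoint_union_left, Set.disjoint_union_right]) <;> grind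

lemma Draw.minor {V : Type*} {G H : SimpleGraph V} (h : Draw G) (hm : Minor G H) : Draw H := by
  induction hm with
  | refl => exact h
  | sub _ h2 ih => exact ih.mono h2
  | contr _ h2 ih => exact ih.contr h2

lemma Draw.cliqueFree {V : Type*} {G : SimpleGraph V} (h : Draw G) : G.CliqueFree 5 := by
  rw [SimpleGraph.cliqueFree_iff]
  refine ⟨fun f => ?_⟩
  obtain ⟨p, E, h1, h2⟩ := h
  have hadj : ∀ i j : Fin 5, i ≠ j → G.Adj (f i) (f j) := fun i j hij =>
    f.toHom.map_adj (by simpa using hij)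
  have hinj : ∀ i j : Fin 5, i ≠ j → f i ≠ f j := fun i j hij => (hadj i j hij).ne
  have hex : ∀ i j : Fin 5, ∃ g : ℝ → ℂ, i < j → Continuous g ∧ g 0 = p (f i) ∧ g 1 = p (f j) ∧
      ∀ t, g t ∈ E (f i) (f j) := by
    intro i j
    by_cases hij : i < j
    · obtain ⟨γ, hγ⟩ := h1 _ _ (hadj i j hij.ne)
      refine ⟨γ.extend, fun _ => ⟨γ.continuous_extend, γ.extend_zero, γ.extend_one, ?_⟩⟩
      intro t
      have : γ.extend t ∈ Set.range γ := by
        rw [← γ.extend_range]; exact Set.mem_range_self _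
      obtain ⟨s, hs⟩ := this
      rw [← hs]; exact hγ s
    · exact ⟨fun _ => 0, fun h => absurd h hij⟩
  choose g hg using hex
  refine no_K5 (fun i => p (f i)) g (fun i j h => (hg i j h).1) (fun i j h => (hg i j h).2.1)
    (fun i j h => (hg i j h).2.2.1) ?_
  intro i j k l hij hkl n1 n2 n3 n4 s t he
  have hd := h2 _ _ _ _ (hadj i j hij.ne) (hadj k l hkl.ne) (hinj _ _ n1) (hinj _ _ n2)
    (hinj _ _ n3) (hinj _ _ n4)
  exact Set.disjoint_left.1 hd ((hg i j hij).2.2.2 s) (he ▸ (hg k l hkl).2.2.2 t)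

lemma draw_of_planar {V : Type*} {G : SimpleGraph V} (hG : IsPlanar G) : Draw G := by
  obtain ⟨vm, em, h⟩ := hG
  let φ : ℝ × ℝ → ℂ := Complex.equivRealProdCLM.symm
  have hφ : Continuous φ := Complex.equivRealProdCLM.symm.continuous
  have hφi : Function.Injective φ := Complex.equivRealProdCLM.symm.injective
  refine ⟨fun v => φ (vm v), fun u v => (fun t => φ (em u v t)) '' Set.Icc 0 1, ?_, ?_⟩
  · intro u v huv
    have hc : ContinuousOn (fun t => φ (em u v t)) (Set.Icc 0 1) :=
      hφ.comp_continuousOn (h.cont u v huv)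
    refine ⟨⟨⟨fun t : unitInterval => φ (em u v t), ?_⟩, ?_, ?_⟩, ?_⟩
    · exact continuousOn_iff_continuous_domRestrict.1 hc
    · simp [h.ends0 u v huv]
    · simp [h.ends1 u v huv]
    · intro t
      exact ⟨t, t.2, rfl⟩
  · intro u v x y huv hxy n1 n2 n3 n4
    rw [Set.disjoint_left]
    rintro _ ⟨s, hs, rfl⟩ ⟨t, ht, he⟩
    have he : em x y t = em u v s := hφi he
    have hcase : ∀ a b, G.Adj a b → ∀ r ∈ Set.Icc (0:ℝ) 1,
        em a b r = vm a ∨ em a b r = vm b ∨ r ∈ Set.Ioo (0:ℝ) 1 := by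
      intro a b hab r hr
      rcases hr.1.eq_or_lt with h0 | h0
      · left; rw [← h0]; exact h.ends0 a b hab
      rcases hr.2.eq_or_lt with h1 | h1
      · right; left; rw [h1]; exact h.ends1 a b hab
      · exact Or.inr (Or.inr ⟨h0, h1⟩)
    have hv : ∀ a b, a ≠ b → vm a ≠ vm b := fun a b hab he => hab (h.vinj he)
    rcases hcase u v huv s hs with a | a | a <;> rcases hcase x y hxy t ht with b | b | b
    · exact hv _ _ n1 (by rw [← a, ← b, he])
    · exact hv _ _ n2 (by rw [← a, ← b, he])
    · exact h.interior_avoids _ _ hxy t b u (by rw [he, a])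
    · exact hv _ _ n3 (by rw [← a, ← b, he])
    · exact hv _ _ n4 (by rw [← a, ← b, he])
    · exact h.interior_avoids _ _ hxy t b v (by rw [he, a])
    · exact h.interior_avoids _ _ huv s a x (by rw [← he, b])
    · exact h.interior_avoids _ _ huv s a y (by rw [← he, b])
    · refine h.edges_disjoint _ _ _ _ huv hxy ?_ s a t b he.symm
      intro hs
      rw [Sym2.eq_iff] at hs
      rcases hs with ⟨q, _⟩ | ⟨q, _⟩
      · exact n1 q
      · exact n2 q

end PC

/-- Every planar graph on `n ≥ 3` vertices has at most `8n - 16` cliques. -/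
theorem cliqueCount_le_of_planar {V : Type*} [Fintype V] (G : SimpleGraph V)
    (hn : 3 ≤ Fintype.card V) (hG : IsPlanar G) :
    cliqueCount G ≤ 8 * Fintype.card V - 16 := by
  have hF : PC.Free 5 G := fun H hH => ((PC.draw_of_planar hG).minor hH).cliqueFree
  have := PC.cc_bound (S := Finset.univ) (fun x y _ => Finset.mem_univ x) hF
    (by rwa [Finset.card_univ])
  have e : cliqueCount G = (PC.cc G Finset.univ).card := by
    unfold cliqueCount PC.cc
    rw [Finset.powerset_univ]
  rw [Finset.card_univ] at this
  omega
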